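/- Assume n ≥ 2, x₁,…,xₙ > 0 not all equal, r₀ > −1, r∞ ∈ ℝ, k ∈ ℝ with n > max(2(r∞+1), k+1), and π_η : (0,∞) → (0,∞) continuous with π_η(η) ∝_{η→0⁺} η^{r₀} and π_η(η) ∝_{η→∞} η^{r∞}. Then s₂ := ∫₁^∞ ∫₁^∞ h(β,η) dβ dη < ∞. -/

import Mathlib

open MeasureTheory Filter Set

/-- The modified Bessel function of the first kind of order 0:
`I₀(x) = ∑ (x/2)^(2m) / (m!)²`. -/
noncomputable def besselI0 (x : ℝ) : ℝ :=
  ∑' m : ℕ, (x / 2) ^ (2 * m) / ((Nat.factorial m : ℝ)) ^ 2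

/-- `I₀*(y) = e^(−y) I₀(y)`. -/
noncomputable def besselI0star (y : ℝ) : ℝ := Real.exp (-y) * besselI0 y

/-- `a(t) ∝ b(t)` along the filter `l`: the liminf of `a/b` is positive and the
limsup of `a/b` is finite (computed in `[0,∞]`). -/
def PropAt (a b : ℝ → ℝ) (l : Filter ℝ) : Prop :=
  0 < Filter.liminf (fun t => ENNReal.ofReal (a t / b t)) l ∧
    Filter.limsup (fun t => ENNReal.ofReal (a t / b t)) l < ⊤

/-- `h(β,η) = π_η(η)·β^(n−(k+3)/2)·η^((k+1)/2−n)·∏ᵢ I₀*(β xᵢ)·exp(−β ∑ᵢ (xᵢ−η)²/(2η))`. -/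
noncomputable def hFun (n : ℕ) (x : Fin n → ℝ) (k : ℝ) (πη : ℝ → ℝ) (β η : ℝ) : ℝ :=
  πη η * β ^ ((n : ℝ) - (k + 3) / 2) * η ^ ((k + 1) / 2 - (n : ℝ)) *
    (∏ i, besselI0star (β * x i)) *
    Real.exp (-(β * ∑ i, (x i - η) ^ 2 / (2 * η)))

theorem besselI0_term_le_cosh_term (x : ℝ) (m : ℕ) :
    (x / 2) ^ (2 * m) / (Nat.factorial m : ℝ) ^ 2 ≤
      x ^ (2 * m) / (Nat.factorial (2 * m) : ℝ) := by
  have hf : (Nat.factorial (2 * m) : ℝ) ≤ 2 ^ (2 * m) * (Nat.factorial m : ℝ) ^ 2 := by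
    have h := Nat.choose_mul_factorial_mul_factorial (show m ≤ 2 * m by lia)
    rw [show 2 * m - m = m by lia] at h
    have : Nat.factorial (2 * m) ≤ 2 ^ (2 * m) * Nat.factorial m ^ 2 := by
      rw [← h, sq, mul_assoc]
      exact Nat.mul_le_mul_right _ (Nat.choose_le_two_pow (2 * m) m)
    exact_mod_cast this
  rw [div_pow, div_div]
  have hx : 0 ≤ x ^ (2 * m) := by rw [pow_mul]; positivity
  gcongr

theorem summable_besselI0 (x : ℝ) :
    Summable (fun m : ℕ => (x / 2) ^ (2 * m) / (Nat.factorial m : ℝ) ^ 2) := by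
  refine .of_nonneg_of_le (fun m => ?_) (besselI0_term_le_cosh_term x)
    (Real.hasSum_cosh x).summable
  rw [pow_mul]; positivity

theorem besselI0_nonneg (x : ℝ) : 0 ≤ besselI0 x :=
  tsum_nonneg fun m => by rw [pow_mul]; positivity

theorem besselI0_le_cosh (x : ℝ) : besselI0 x ≤ Real.cosh x := by
  rw [besselI0, ← (Real.hasSum_cosh x).tsum_eq]
  exact (summable_besselI0 x).tsum_le_tsum (besselI0_term_le_cosh_term x)
    (Real.hasSum_cosh x).summable

theorem besselI0star_nonneg (y : ℝ) : 0 ≤ besselI0star y :=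
  mul_nonneg (Real.exp_pos _).le (besselI0_nonneg y)

theorem besselI0star_le_one {y : ℝ} (hy : 0 ≤ y) : besselI0star y ≤ 1 := by
  have h1 : besselI0 y ≤ Real.exp y := by
    refine (besselI0_le_cosh y).trans ?_
    rw [Real.cosh_eq]
    have : Real.exp (-y) ≤ Real.exp y := Real.exp_le_exp.2 (by linarith)
    linarith
  calc besselI0star y ≤ Real.exp (-y) * Real.exp y :=
        mul_le_mul_of_nonneg_left h1 (Real.exp_pos _).le
    _ = 1 := by rw [← Real.exp_add]; simp

theorem lintegral_Ioi_one_rpow_mul_exp_neg_lt_top (p : ℝ) {c : ℝ} (hc : 0 < c) :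
    ∫⁻ t in Ioi (1 : ℝ), ENNReal.ofReal (t ^ p * Real.exp (-(c * t))) < ⊤ := by
  have hint : IntegrableOn (fun t : ℝ => t ^ |p| * Real.exp (-c * t ^ (1 : ℝ))) (Ioi 1) :=
    (integrableOn_rpow_mul_exp_neg_mul_rpow
      (by linarith [abs_nonneg p]) zero_lt_one hc).mono_set (Ioi_subset_Ioi zero_le_one)
  refine lt_of_le_of_lt (setLIntegral_mono' measurableSet_Ioi fun t ht => ?_)
    hint.lintegral_lt_top
  rw [mem_Ioi] at ht
  refine ENNReal.ofReal_le_ofReal ?_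
  rw [Real.rpow_one, neg_mul]
  gcongr
  · exact ht.le
  · exact le_abs_self p

/-- A continuous function with controlled growth at infinity is bounded by a power on `(1, ∞)`. -/
theorem PropAt.exists_le_mul_rpow {f : ℝ → ℝ} {r : ℝ} (hf : ContinuousOn f (Ioi 0))
    (h : PropAt f (fun t => t ^ r) atTop) :
    ∃ C : ℝ, 0 ≤ C ∧ ∀ t, 1 < t → f t ≤ C * t ^ r := by
  obtain ⟨a, ha, hatop⟩ := ENNReal.lt_iff_exists_nnreal_btwn.1 h.2
  obtain ⟨R, hR⟩ := eventually_atTop.1 (eventually_lt_of_limsup_lt ha)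
  have hcont : ContinuousOn (fun t : ℝ => f t / t ^ r) (Icc 1 R) := by
    have hpos : ∀ t ∈ Icc (1 : ℝ) R, 0 < t := fun t ht => zero_lt_one.trans_le ht.1
    exact (hf.mono hpos).div
      (continuousOn_id.rpow_const fun t ht => Or.inl (hpos t ht).ne')
      fun t ht => (Real.rpow_pos_of_pos (hpos t ht) r).ne'
  obtain ⟨B, hB⟩ := isCompact_Icc.bddAbove_image hcont
  refine ⟨max a B, a.2.trans (le_max_left _ _), fun t ht => ?_⟩
  have htr : 0 < t ^ r := Real.rpow_pos_of_pos (by linarith) r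
  rw [← div_le_iff₀ htr]
  rcases le_total t R with htR | htR
  · exact (hB ⟨t, ⟨ht.le, htR⟩, rfl⟩).trans (le_max_right _ _)
  · refine le_trans ?_ (le_max_left _ _)
    have h1 := (hR t htR).le
    rw [← ENNReal.ofReal_coe_nnreal] at h1
    exact (ENNReal.ofReal_le_ofReal_iff a.2).1 h1

theorem exists_mul_le_sum_sq_sub_div {ι : Type*} [Fintype ι] {x : ι → ℝ}
    (hne : ∃ i j, x i ≠ x j) :
    ∃ c : ℝ, 0 < c ∧ ∀ η, 0 < η → c * η ≤ ∑ i, (x i - η) ^ 2 / (2 * η) := by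
  classical
  obtain ⟨i, j, hij⟩ := hne
  have hs : 0 < (x i - x j) ^ 2 := by
    have := sub_ne_zero.2 hij
    positivity
  have hq : 0 < x i ^ 2 + x j ^ 2 := by nlinarith [sq_nonneg (x i + x j)]
  refine ⟨(x i - x j) ^ 2 / (2 * (x i ^ 2 + x j ^ 2)), by positivity, fun η hη => ?_⟩
  calc (x i - x j) ^ 2 / (2 * (x i ^ 2 + x j ^ 2)) * η
      ≤ (x i - η) ^ 2 / (2 * η) + (x j - η) ^ 2 / (2 * η) := by
        rw [← add_div, div_mul_eq_mul_div, div_le_div_iff₀ (by positivity) (by positivity)]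
        nlinarith [sq_nonneg (x i ^ 2 + x j ^ 2 - (x i + x j) * η)]
    _ = ∑ l ∈ {i, j}, (x l - η) ^ 2 / (2 * η) :=
        (Finset.sum_pair (f := fun l => (x l - η) ^ 2 / (2 * η))
          fun h => hij (congrArg x h)).symm
    _ ≤ ∑ l, (x l - η) ^ 2 / (2 * η) :=
        Finset.sum_le_sum_of_subset_of_nonneg (Finset.subset_univ _)
          fun l _ _ => by positivity

theorem stmt_12 (n : ℕ) (hn : 2 ≤ n) (x : Fin n → ℝ) (hx : ∀ i, 0 < x i)
    (hne : ∃ i j, x i ≠ x j)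
    (k r₀ rinf : ℝ) (hr₀ : r₀ > -1)
    (hnbig : (n : ℝ) > max (2 * (rinf + 1)) (k + 1))
    (πη : ℝ → ℝ) (hπη : ContinuousOn πη (Set.Ioi 0))
    (hπηpos : ∀ η : ℝ, 0 < η → 0 < πη η)
    (hprop0 : PropAt πη (fun η => η ^ r₀) (nhdsWithin 0 (Set.Ioi 0)))
    (hpropInf : PropAt πη (fun η => η ^ rinf) Filter.atTop) :
    (∫⁻ η in Set.Ioi (1 : ℝ), ∫⁻ β in Set.Ioi (1 : ℝ),
      ENNReal.ofReal (hFun n x k πη β η)) < ⊤ := by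
  obtain ⟨C, hC, hCle⟩ := hpropInf.exists_le_mul_rpow hπη
  obtain ⟨c, hc, hcle⟩ := exists_mul_le_sum_sq_sub_div hne
  set p : ℝ := (n : ℝ) - (k + 3) / 2
  set q : ℝ := (k + 1) / 2 - (n : ℝ)
  have hbound : ∀ η, 1 < η → ∀ β, 1 < β → hFun n x k πη β η ≤
      C * (η ^ (rinf + q) * Real.exp (-(c / 2 * η))) *
        (β ^ p * Real.exp (-(c / 2 * β))) := by
    intro η hη β hβ
    have hη0 : 0 < η := by linarith
    have hβ0 : 0 < β := by linarith
    have hprod : ∏ i, besselI0star (β * x i) ≤ 1 :=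
      Finset.prod_le_one (fun i _ => besselI0star_nonneg _)
        fun i _ => besselI0star_le_one (mul_pos hβ0 (hx i)).le
    have hexp : Real.exp (-(β * ∑ i, (x i - η) ^ 2 / (2 * η))) ≤
        Real.exp (-(c / 2 * η)) * Real.exp (-(c / 2 * β)) := by
      rw [← Real.exp_add, Real.exp_le_exp]
      have h1 := mul_le_mul_of_nonneg_left (hcle η hη0) hβ0.le
      have h2 : 0 ≤ c * ((β - 1) * η + (η - 1) * β) :=
        mul_nonneg hc.le (add_nonneg (mul_nonneg (by linarith) hη0.le)
          (mul_nonneg (by linarith) hβ0.le))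
      nlinarith
    have hπ0 := (hπηpos η hη0).le
    calc hFun n x k πη β η
        ≤ (C * η ^ rinf) * β ^ p * η ^ q * 1 *
          (Real.exp (-(c / 2 * η)) * Real.exp (-(c / 2 * β))) := by
          unfold hFun
          have hprod0 : 0 ≤ ∏ i, besselI0star (β * x i) :=
            Finset.prod_nonneg fun i _ => besselI0star_nonneg _
          have := hCle η hη
          gcongr
      _ = _ := by rw [Real.rpow_add hη0]; ring
  have hJ := lintegral_Ioi_one_rpow_mul_exp_neg_lt_top p (half_pos hc)
  have hK := lintegral_Ioi_one_rpow_mul_exp_neg_lt_top (rinf + q) (half_pos hc)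
  set J := ∫⁻ t in Ioi (1 : ℝ), ENNReal.ofReal (t ^ p * Real.exp (-(c / 2 * t)))
  calc ∫⁻ η in Ioi (1 : ℝ), ∫⁻ β in Ioi (1 : ℝ), ENNReal.ofReal (hFun n x k πη β η)
      ≤ ∫⁻ η in Ioi (1 : ℝ), ENNReal.ofReal C * J *
          ENNReal.ofReal (η ^ (rinf + q) * Real.exp (-(c / 2 * η))) := by
        refine setLIntegral_mono' measurableSet_Ioi fun η hη => ?_
        rw [mem_Ioi] at hη
        calc ∫⁻ β in Ioi (1 : ℝ), ENNReal.ofReal (hFun n x k πη β η)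
            ≤ ∫⁻ β in Ioi (1 : ℝ),
                ENNReal.ofReal (C * (η ^ (rinf + q) * Real.exp (-(c / 2 * η)))) *
                  ENNReal.ofReal (β ^ p * Real.exp (-(c / 2 * β))) := by
              refine setLIntegral_mono' measurableSet_Ioi fun β hβ => ?_
              rw [← ENNReal.ofReal_mul (by positivity)]
              exact ENNReal.ofReal_le_ofReal (hbound η hη β hβ)
          _ = ENNReal.ofReal C * J *
                ENNReal.ofReal (η ^ (rinf + q) * Real.exp (-(c / 2 * η))) := by
              rw [lintegral_const_mul' _ _ ENNReal.ofReal_ne_top, ENNReal.ofReal_mul hC]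
              ring
    _ = ENNReal.ofReal C * J * ∫⁻ η in Ioi (1 : ℝ),
          ENNReal.ofReal (η ^ (rinf + q) * Real.exp (-(c / 2 * η))) :=
        lintegral_const_mul' _ _ (ENNReal.mul_ne_top ENNReal.ofReal_ne_top hJ.ne)
    _ < ⊤ := ENNReal.mul_lt_top (ENNReal.mul_lt_top ENNReal.ofReal_lt_top hJ) hK
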